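/- arXiv:2405.08709 — 2 statements merged into one kernel-verified Lean document; each statement's English description precedes it below -/
import Mathlib

section
/- Let S, Y, U be random variables on a common probability space with values in nonempty finite sets and let ε ≥ 0. If I(U;S) = ε and H(Y|S,U) = 0, then I(U;Y) ≥ H(Y|S) − H(S|Y) + ε. -/
open MeasureTheory ProbabilityTheory Real

noncomputable section

/-- The probability mass function of a random variable `X` under the measure `μ`. -/
def pm {Ω : Type*} [MeasurableSpace Ω] (μ : Measure Ω) {𝒳 : Type*} (X : Ω → 𝒳) (x : 𝒳) : ℝ :=
  (μ (X ⁻¹' {x})).toReal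

/-- Shannon entropy (base 2) of a finite-valued random variable. -/
def ent {Ω : Type*} [MeasurableSpace Ω] (μ : Measure Ω) {𝒳 : Type*} [Fintype 𝒳]
    (X : Ω → 𝒳) : ℝ :=
  -∑ x, pm μ X x * Real.logb 2 (pm μ X x)

/-- Conditional entropy `H(X|Y) = H(X,Y) - H(Y)` (base 2). -/
def condEnt {Ω : Type*} [MeasurableSpace Ω] (μ : Measure Ω) {𝒳 𝒴 : Type*} [Fintype 𝒳]
    [Fintype 𝒴] (X : Ω → 𝒳) (Y : Ω → 𝒴) : ℝ :=
  ent μ (fun ω => (X ω, Y ω)) - ent μ Y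

/-- Mutual information `I(X;Y) = H(X) + H(Y) - H(X,Y)` (base 2). -/
def mi {Ω : Type*} [MeasurableSpace Ω] (μ : Measure Ω) {𝒳 𝒴 : Type*} [Fintype 𝒳]
    [Fintype 𝒴] (X : Ω → 𝒳) (Y : Ω → 𝒴) : ℝ :=
  ent μ X + ent μ Y - ent μ (fun ω => (X ω, Y ω))

/-- Conditional mutual information `I(X;Y|Z) = H(X|Z) + H(Y|Z) - H((X,Y)|Z)` (base 2). -/
def condMI {Ω : Type*} [MeasurableSpace Ω] (μ : Measure Ω) {𝒳 𝒴 𝒵 : Type*} [Fintype 𝒳]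
    [Fintype 𝒴] [Fintype 𝒵] (X : Ω → 𝒳) (Y : Ω → 𝒴) (Z : Ω → 𝒵) : ℝ :=
  condEnt μ X Z + condEnt μ Y Z - condEnt μ (fun ω => (X ω, Y ω)) Z

theorem pm_comp_eq_sum {Ω : Type*} [MeasurableSpace Ω] (μ : Measure Ω) [IsFiniteMeasure μ]
    {𝒳 𝒵 : Type*} [Fintype 𝒳] [MeasurableSpace 𝒳] [MeasurableSingletonClass 𝒳] [DecidableEq 𝒵]
    {X : Ω → 𝒳} (hX : Measurable X) (f : 𝒳 → 𝒵) (z : 𝒵) :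
    pm μ (fun ω => f (X ω)) z = ∑ x with f x = z, pm μ X x := by
  have h := sum_measure_preimage_singleton (μ := μ) (f := X) (Finset.univ.filter (f · = z))
    fun x _ => hX (measurableSet_singleton x)
  simp only [pm]
  rw [← ENNReal.toReal_sum fun x _ => measure_ne_top μ _, h]
  congr 2
  ext ω
  simp

/-- Applying a function to a random variable does not increase its entropy. -/
theorem ent_comp_le {Ω : Type*} [MeasurableSpace Ω] (μ : Measure Ω) [IsFiniteMeasure μ]
    {𝒳 𝒵 : Type*} [Fintype 𝒳] [MeasurableSpace 𝒳] [MeasurableSingletonClass 𝒳] [Fintype 𝒵]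
    {X : Ω → 𝒳} (hX : Measurable X) (f : 𝒳 → 𝒵) :
    ent μ (fun ω => f (X ω)) ≤ ent μ X := by
  classical
  have pm_nonneg (x : 𝒳) : 0 ≤ pm μ X x := ENNReal.toReal_nonneg
  have pm_le (x : 𝒳) : pm μ X x ≤ pm μ (fun ω => f (X ω)) (f x) := by
    rw [pm_comp_eq_sum μ hX f]
    exact Finset.single_le_sum (fun x _ => pm_nonneg x) (by simp)
  have sum_eq : ∑ z, pm μ (fun ω => f (X ω)) z * logb 2 (pm μ (fun ω => f (X ω)) z) =
      ∑ x, pm μ X x * logb 2 (pm μ (fun ω => f (X ω)) (f x)) := by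
    rw [← Finset.sum_fiberwise Finset.univ f]
    refine Finset.sum_congr rfl fun z _ => ?_
    nth_rewrite 1 [pm_comp_eq_sum μ hX f z]
    rw [Finset.sum_mul]
    refine Finset.sum_congr rfl fun x hx => ?_
    rw [(Finset.mem_filter.mp hx).2]
  unfold ent
  rw [sum_eq, neg_le_neg_iff]
  refine Finset.sum_le_sum fun x _ => ?_
  rcases (pm_nonneg x).eq_or_lt with h | h
  · simp [← h]
  · exact mul_le_mul_of_nonneg_left (logb_le_logb_of_le one_lt_two h (pm_le x)) h.le

/-- The joint entropy of two random variables is symmetric. -/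
theorem ent_prod_comm {Ω : Type*} [MeasurableSpace Ω] (μ : Measure Ω) [IsFiniteMeasure μ]
    {𝒳 𝒵 : Type*} [Fintype 𝒳] [MeasurableSpace 𝒳] [MeasurableSingletonClass 𝒳]
    [Fintype 𝒵] [MeasurableSpace 𝒵] [MeasurableSingletonClass 𝒵]
    {X : Ω → 𝒳} {Z : Ω → 𝒵} (hX : Measurable X) (hZ : Measurable Z) :
    ent μ (fun ω => (X ω, Z ω)) = ent μ (fun ω => (Z ω, X ω)) :=
  le_antisymm (ent_comp_le μ (hZ.prodMk hX) Prod.swap) (ent_comp_le μ (hX.prodMk hZ) Prod.swap)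

/-- If `I(U;S) = ε` with `ε ≥ 0` and `H(Y|S,U) = 0`, then
`I(U;Y) ≥ H(Y|S) − H(S|Y) + ε`. -/
theorem utility_lower_bound_of_leakage_eq
    {Ω : Type*} [MeasurableSpace Ω] (μ : Measure Ω) [IsProbabilityMeasure μ]
    {𝒮 𝒴 𝒰 : Type*}
    [Fintype 𝒮] [Nonempty 𝒮] [MeasurableSpace 𝒮] [MeasurableSingletonClass 𝒮]
    [Fintype 𝒴] [Nonempty 𝒴] [MeasurableSpace 𝒴] [MeasurableSingletonClass 𝒴]
    [Fintype 𝒰] [Nonempty 𝒰] [MeasurableSpace 𝒰] [MeasurableSingletonClass 𝒰]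
    (S : Ω → 𝒮) (Y : Ω → 𝒴) (U : Ω → 𝒰)
    (hS : Measurable S) (hY : Measurable Y) (hU : Measurable U)
    (ε : ℝ) (hε0 : 0 ≤ ε) (hleak : mi μ U S = ε)
    (hdet : condEnt μ Y (fun ω => (S ω, U ω)) = 0) :
    mi μ U Y ≥ condEnt μ Y S - condEnt μ S Y + ε := by
  have hUY := ent_comp_le μ (hY.prodMk (hS.prodMk hU)) fun p => (p.2.2, p.1)
  have hSY := ent_prod_comm μ hS hY
  have hSU := ent_prod_comm μ hS hU
  simp only [mi, condEnt] at *
  linarith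
end
end

section
/- Let S, Y be random variables on a probability space with values in nonempty finite sets and let 0 ≤ ε < I(S;Y); set α = ε/H(S). Then there exist a probability space carrying random variables S', Y' whose joint distribution equals that of (S,Y) and a finite-valued random variable U such that I(U;S') ≤ ε and I(U;Y') ≥ H(Y|S) − α·H(S|Y) + ε − (1−α)·(log(I(S;Y)+1) + 4), where log is base 2. This is the achievability of the lower bound L_h^2(ε) of Theorem 1. -/
open MeasureTheory ProbabilityTheory Real

noncomputable section

/-- The standard exponential law on `ℝ`. -/
def expLaw : Measure ℝ :=
  (volume.restrict (Set.Ioi 0)).withDensity fun x => ENNReal.ofReal (Real.exp (-x))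

lemma lintegral_expLaw {g : ℝ → ENNReal} (hg : Measurable g) :
    ∫⁻ t, g t ∂expLaw = ∫⁻ t in Set.Ioi 0, ENNReal.ofReal (Real.exp (-t)) * g t := by
  unfold expLaw
  rw [lintegral_withDensity_eq_lintegral_mul _ (by fun_prop) hg]
  rfl

lemma lintegral_Ioi_exp_neg_mul {r : ℝ} (hr : 0 < r) :
    ∫⁻ t in Set.Ioi (0 : ℝ), ENNReal.ofReal (Real.exp (-(r * t))) = ENNReal.ofReal (1 / r) := by
  have h := Real.integral_rpow_mul_exp_neg_mul_Ioi (a := 1) (r := r) one_pos hr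
  have hint : IntegrableOn (fun t : ℝ => Real.exp (-(r * t))) (Set.Ioi 0) := by
    simpa [neg_mul] using integrableOn_exp_mul_Ioi (a := -r) (by linarith) 0
  rw [← ofReal_integral_eq_lintegral_ofReal hint (Filter.Eventually.of_forall fun _ => by positivity)]
  congr 1
  simpa using h

lemma lintegral_Ioi_mul_exp_neg_mul {r : ℝ} (hr : 0 < r) :
    ∫⁻ t in Set.Ioi (0 : ℝ), ENNReal.ofReal (t * Real.exp (-(r * t)))
      = ENNReal.ofReal ((1 / r) ^ 2) := by
  have h := Real.integral_rpow_mul_exp_neg_mul_Ioi (a := 2) (r := r) two_pos hr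
  have h2 : ∫ t in Set.Ioi (0 : ℝ), t * Real.exp (-(r * t)) = (1 / r) ^ 2 := by
    norm_num at h
    simpa using h
  have hint : IntegrableOn (fun t : ℝ => t * Real.exp (-(r * t))) (Set.Ioi 0) := by
    apply not_imp_comm.1 integral_undef
    rw [h2]; positivity
  rw [← ofReal_integral_eq_lintegral_ofReal hint, h2]
  filter_upwards [ae_restrict_mem measurableSet_Ioi] with t ht
  exact mul_nonneg (le_of_lt ht) (Real.exp_pos _).le

instance : IsProbabilityMeasure expLaw := by
  constructor
  rw [← lintegral_one, lintegral_expLaw measurable_const]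
  simpa using lintegral_Ioi_exp_neg_mul one_pos

lemma expLaw_apply {s : Set ℝ} (hs : MeasurableSet s) :
    expLaw s = ∫⁻ t in s ∩ Set.Ioi 0, ENNReal.ofReal (Real.exp (-t)) := by
  rw [expLaw, withDensity_apply _ hs, Measure.restrict_restrict hs]

lemma expLaw_Ici_le {a : ℝ} : expLaw (Set.Ici a) ≤ ENNReal.ofReal (Real.exp (-a)) := by
  rw [expLaw_apply measurableSet_Ici]
  refine (lintegral_mono_set Set.inter_subset_left).trans ?_
  rw [setLIntegral_congr Ioi_ae_eq_Ici.symm,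
    ← ofReal_integral_eq_lintegral_ofReal (integrableOn_exp_neg_Ioi a)
      (Filter.Eventually.of_forall fun _ => by positivity), integral_exp_neg_Ioi]

lemma expLaw_Ici_inter_Iic_le {a b : ℝ} (ha : 0 ≤ a) :
    expLaw (Set.Ici a ∩ Set.Iic b) ≤ ENNReal.ofReal (Real.exp (-a) * b) := by
  rw [expLaw_apply (measurableSet_Ici.inter measurableSet_Iic)]
  refine (lintegral_mono_set Set.inter_subset_left).trans ?_
  rw [Set.Ici_inter_Iic]
  calc ∫⁻ t in Set.Icc a b, ENNReal.ofReal (Real.exp (-t))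
      ≤ ∫⁻ t in Set.Icc a b, ENNReal.ofReal (Real.exp (-a)) := by
        refine setLIntegral_mono measurable_const fun t ht => ?_
        gcongr
        exact ht.1
    _ = ENNReal.ofReal (Real.exp (-a)) * ENNReal.ofReal (b - a) := by simp
    _ ≤ ENNReal.ofReal (Real.exp (-a)) * ENNReal.ofReal b := by gcongr; linarith
    _ = _ := (ENNReal.ofReal_mul (Real.exp_pos _).le).symm

lemma expLaw_ae_pos : ∀ᵐ t ∂expLaw, 0 < t :=
  (withDensity_absolutelyContinuous _ _).ae_le (ae_restrict_mem measurableSet_Ioi)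

lemma pi_forall_ne_eq_lintegral {ι : Type*} [Fintype ι] [DecidableEq ι] (ν : Measure ℝ)
    [IsProbabilityMeasure ν] (y : ι) (A : ι → Set (ℝ × ℝ)) (hA : ∀ i, MeasurableSet (A i)) :
    Measure.pi (fun _ : ι => ν) {E | ∀ i, i ≠ y → (E y, E i) ∈ A i}
      = ∫⁻ t, ∏ i ∈ Finset.univ.erase y, ν (Prod.mk t ⁻¹' A i) ∂ν := by
  have hmp := measurePreserving_piEquivPiSubtypeProd (fun _ : ι => ν) (fun i => i = y)
  set B : Set (({i // i = y} → ℝ) × ({i // ¬ i = y} → ℝ)) :=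
    {z | ∀ j, (z.1 ⟨y, rfl⟩, z.2 j) ∈ A j.1} with hB
  have hBm : MeasurableSet B := by
    rw [hB, Set.ofPred_forall]
    refine MeasurableSet.iInter fun j => ?_
    exact (by fun_prop : Measurable fun z : ({i // i = y} → ℝ) × ({i // ¬ i = y} → ℝ) =>
      (z.1 ⟨y, rfl⟩, z.2 j)) (hA j)
  have hpre : {E : ι → ℝ | ∀ i, i ≠ y → (E y, E i) ∈ A i}
      = MeasurableEquiv.piEquivPiSubtypeProd (fun _ => ℝ) (fun i => i = y) ⁻¹' B := by
    ext E
    simp only [Set.mem_ofPred_eq, Set.mem_preimage, hB]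
    exact ⟨fun h j => h j.1 j.2, fun h i hi => h ⟨i, hi⟩⟩
  rw [hpre, hmp.measure_preimage hBm.nullMeasurableSet, Measure.prod_apply hBm]
  have hsl : ∀ a : {i // i = y} → ℝ,
      Measure.pi (fun _ : {i // ¬ i = y} => ν) (Prod.mk a ⁻¹' B)
        = (fun t => ∏ i ∈ Finset.univ.erase y, ν (Prod.mk t ⁻¹' A i)) (a ⟨y, rfl⟩) := by
    intro a
    have : Prod.mk a ⁻¹' B = Set.pi Set.univ
        fun j : {i // ¬ i = y} => Prod.mk (a ⟨y, rfl⟩) ⁻¹' A j.1 := by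
      ext z; simp [hB]
    rw [this, Measure.pi_pi]
    exact (Finset.prod_subtype (p := fun i => ¬ i = y) (Finset.univ.erase y) (by simp)
      fun i => ν (Prod.mk (a ⟨y, rfl⟩) ⁻¹' A i)).symm
  simp_rw [hsl]
  have hm : Measurable fun t => ∏ i ∈ Finset.univ.erase y, ν (Prod.mk t ⁻¹' A i) :=
    Finset.measurable_prod _ fun i _ => measurable_measure_prodMk_left (hA i)
  rw [← (measurePreserving_eval (fun _ : {i // i = y} => ν) ⟨y, rfl⟩).lintegral_comp hm]
  congr!

section Race

variable {ι : Type*} [Fintype ι] [DecidableEq ι]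

lemma race_le_lintegral {p : ι → ℝ} (hp1 : ∑ i, p i = 1) {y : ι}
    (hy : 0 < p y) (A : ι → Set (ℝ × ℝ)) (hA : ∀ i, MeasurableSet (A i)) (g : ι → ℝ → ℝ)
    (hAg : ∀ i t, 0 < t → expLaw (Prod.mk t ⁻¹' A i)
      ≤ ENNReal.ofReal (Real.exp (-(p i * (t / p y))) * g i t)) :
    Measure.pi (fun _ : ι => expLaw) {E | ∀ i, i ≠ y → (E y, E i) ∈ A i}
      ≤ ∫⁻ t in Set.Ioi (0 : ℝ), ENNReal.ofReal (Real.exp (-(1 / p y * t))) *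
          ∏ i ∈ Finset.univ.erase y, ENNReal.ofReal (g i t) := by
  rw [pi_forall_ne_eq_lintegral _ y A hA, lintegral_expLaw
    (Finset.measurable_prod _ fun i _ => measurable_measure_prodMk_left (hA i))]
  refine setLIntegral_mono' measurableSet_Ioi fun t ht => ?_
  calc ENNReal.ofReal (Real.exp (-t)) * ∏ i ∈ Finset.univ.erase y, expLaw (Prod.mk t ⁻¹' A i)
      ≤ ENNReal.ofReal (Real.exp (-t)) * ∏ i ∈ Finset.univ.erase y,
          (ENNReal.ofReal (Real.exp (-(p i * (t / p y)))) * ENNReal.ofReal (g i t)) := by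
        gcongr with i hi
        rw [← ENNReal.ofReal_mul (Real.exp_pos _).le]
        exact hAg i t ht
    _ = _ := by
        rw [Finset.prod_mul_distrib, ← mul_assoc,
          ← ENNReal.ofReal_prod_of_nonneg fun _ _ => (Real.exp_pos _).le,
          ← ENNReal.ofReal_mul (Real.exp_pos _).le, ← Real.exp_sum, ← Real.exp_add]
        congr 4
        have hs : ∑ i ∈ Finset.univ.erase y, p i = 1 - p y := by
          rw [← hp1, ← Finset.add_sum_erase _ _ (Finset.mem_univ y)]; ring
        rw [Finset.sum_neg_distrib, ← Finset.sum_mul, hs]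
        field_simp
        ring

lemma measurableSet_ratio_le (P : Prop) (a b : ℝ) :
    MeasurableSet {z : ℝ × ℝ | P → z.1 / a ≤ z.2 / b} := by
  by_cases h : P
  · simp only [h, true_imp_iff]
    exact measurableSet_le (by fun_prop) (by fun_prop)
  · simp [h]

lemma measurableSet_ratio_ge (P : Prop) (a b : ℝ) :
    MeasurableSet {z : ℝ × ℝ | P → z.2 / a ≤ z.1 / b} :=
  measurable_swap (measurableSet_ratio_le P a b)

lemma race_winner_le {p : ι → ℝ} (hp0 : ∀ i, 0 ≤ p i) (hp1 : ∑ i, p i = 1) {y : ι}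
    (hy : 0 < p y) :
    Measure.pi (fun _ : ι => expLaw) {E | ∀ i, 0 < p i → E y / p y ≤ E i / p i}
      ≤ ENNReal.ofReal (p y) := by
  calc _ ≤ Measure.pi (fun _ : ι => expLaw) {E | ∀ i, i ≠ y →
        (E y, E i) ∈ {z : ℝ × ℝ | 0 < p i → z.1 / p y ≤ z.2 / p i}} :=
        measure_mono fun E (hE : ∀ i, 0 < p i → E y / p y ≤ E i / p i) i _ => hE i
    _ ≤ _ := race_le_lintegral hp1 hy _ (fun i => measurableSet_ratio_le _ _ _)
        (fun _ _ => 1) fun i t ht => ?_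
    _ = ENNReal.ofReal (p y) := by
        simpa using lintegral_Ioi_exp_neg_mul (r := 1 / p y) (by positivity)
  rcases (hp0 i).eq_or_lt with h | h
  · simp [← h]
  · have : Prod.mk t ⁻¹' {z : ℝ × ℝ | 0 < p i → z.1 / p y ≤ z.2 / p i}
        = Set.Ici (p i * (t / p y)) := by
      ext x
      simp [h, le_div_iff₀ h, mul_comm]
    rw [this, mul_one]
    exact expLaw_Ici_le

lemma race_winner_overtaken_le {p : ι → ℝ} (hp0 : ∀ i, 0 ≤ p i) (hp1 : ∑ i, p i = 1) {y j : ι}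
    (hy : 0 < p y) (hj : j ≠ y) {q : ι → ℝ} (hqy : 0 < q y) (hqj : 0 < q j) :
    Measure.pi (fun _ : ι => expLaw) {E | (∀ i, 0 < p i → E y / p y ≤ E i / p i) ∧
        E j / q j ≤ E y / q y}
      ≤ ENNReal.ofReal (p y ^ 2 * (q j / q y)) := by
  calc _ ≤ Measure.pi (fun _ : ι => expLaw) {E | ∀ i, i ≠ y →
        (E y, E i) ∈ {z : ℝ × ℝ | 0 < p i → z.1 / p y ≤ z.2 / p i} ∩
          {z : ℝ × ℝ | i = j → z.2 / q j ≤ z.1 / q y}} := by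
        refine measure_mono fun E hE i _ => ⟨hE.1 i, ?_⟩
        rintro rfl
        exact hE.2
    _ ≤ _ := race_le_lintegral hp1 hy _ (fun i => (measurableSet_ratio_le _ _ _).inter
          (measurableSet_ratio_ge _ _ _))
        (fun i t => if i = j then q j / q y * t else 1) fun i t ht => ?_
    _ = ∫⁻ t in Set.Ioi (0 : ℝ), ENNReal.ofReal (q j / q y) *
          ENNReal.ofReal (t * Real.exp (-(1 / p y * t))) := by
        refine setLIntegral_congr_fun measurableSet_Ioi fun t ht => ?_
        have ht : 0 < t := ht
        have hmem : j ∈ Finset.univ.erase y := by simp [hj]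
        rw [← Finset.mul_prod_erase _ _ hmem, Finset.prod_eq_one]
        · rw [if_pos rfl, mul_one, ← ENNReal.ofReal_mul (by positivity),
            ← ENNReal.ofReal_mul (by positivity)]
          congr 1; ring
        · intro i hi
          simp [(Finset.mem_erase.1 hi).1]
    _ = ENNReal.ofReal (p y ^ 2 * (q j / q y)) := by
        rw [lintegral_const_mul _ (by fun_prop), lintegral_Ioi_mul_exp_neg_mul (by positivity),
          ← ENNReal.ofReal_mul (by positivity), one_div_one_div, mul_comm]
  have hAi : 0 < p i → Prod.mk t ⁻¹' {z : ℝ × ℝ | 0 < p i → z.1 / p y ≤ z.2 / p i}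
        = Set.Ici (p i * (t / p y)) := by
    intro h
    ext x
    simp [h, le_div_iff₀ h, mul_comm]
  have hpos : 0 ≤ p i * (t / p y) := mul_nonneg (hp0 i) (by positivity)
  by_cases hij : i = j
  · subst hij
    have hB : Prod.mk t ⁻¹' {z : ℝ × ℝ | i = i → z.2 / q i ≤ z.1 / q y}
        = Set.Iic (q i / q y * t) := by
      ext x
      simp only [Set.mem_preimage, Set.mem_ofPred_eq, true_imp_iff, Set.mem_Iic, div_le_iff₀ hqj]
      rw [div_mul_eq_mul_div, div_mul_eq_mul_div, mul_comm t]
    rw [Set.preimage_inter, hB, if_pos rfl]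
    refine (measure_mono_ae ?_).trans (expLaw_Ici_inter_Iic_le hpos)
    filter_upwards [expLaw_ae_pos] with x hx hmem
    refine ⟨?_, hmem.2⟩
    rcases (hp0 i).eq_or_lt with h | h
    · simpa [← h] using hx.le
    · rw [← hAi h]; exact hmem.1
  · rw [if_neg hij, mul_one, Set.preimage_inter]
    refine (measure_mono Set.inter_subset_left).trans ?_
    rcases (hp0 i).eq_or_lt with h | h
    · simp [← h]
    · rw [hAi h]
      exact expLaw_Ici_le

end Race

/-- Push-forward of a probability law to a finite type: sums of the weights of the fibres. -/
lemma sum_ite_measureReal_fiber {β : Type*} [MeasurableSpace β] (ρ : Measure β)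
    [IsProbabilityMeasure ρ] {N : ℕ} {R : β → Fin N} (hR : ∀ c, MeasurableSet (R ⁻¹' {c}))
    (φ : Fin N → Prop) [DecidablePred φ] :
    ∑ c, (if φ c then ρ.real (R ⁻¹' {c}) else 0) = ρ.real {E | φ (R E)} := by
  rw [← Finset.sum_filter, ← measureReal_biUnion_finset]
  · congr 1
    ext E
    simp
  · intro a _ b _ hab
    exact (Set.disjoint_singleton.2 hab).preimage R
  · exact fun c _ => hR c

/-- A finite set of configurations of an exponential race between the elements of `𝒴`, run
simultaneously for all rate vectors `p s`: `f c s` is the winner for `p s` and `K c y` is the rank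
of `y` in the race with rate vector `q`. -/
lemma exists_exponential_race {𝒮 𝒴 : Type*} [Fintype 𝒮] [Fintype 𝒴] [DecidableEq 𝒴]
    {p : 𝒮 → 𝒴 → ℝ} (hp0 : ∀ s y, 0 ≤ p s y) (hp1 : ∀ s, ∑ y, p s y = 1)
    {q : 𝒴 → ℝ} (hq0 : ∀ y, 0 ≤ q y) (hq1 : ∑ y, q y = 1) :
    ∃ (N : ℕ) (w : Fin N → ℝ) (f : Fin N → 𝒮 → 𝒴) (v : Fin N → 𝒴 → ℝ),
      (∀ c, 0 ≤ w c) ∧ ∑ c, w c = 1 ∧ (∀ c s, 0 < p s (f c s)) ∧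
      (∀ s y, ∑ c, (if f c s = y then w c else 0) = p s y) ∧
      ∀ s y, 0 < q y → ∑ c, (if f c s = y then
        w c * ((Finset.univ.filter fun j => 0 < q j).filter fun j => v c j ≤ v c y).card else 0)
          ≤ p s y * (1 + p s y / q y) := by
  classical
  set ρ : Measure (𝒴 → ℝ) := Measure.pi fun _ => expLaw
  let r : Option 𝒮 → 𝒴 → ℝ := fun o => o.elim q p
  let R : (𝒴 → ℝ) → (Option 𝒮 × 𝒴 × 𝒴) → Prop :=
    fun E k => E k.2.1 / r k.1 k.2.1 ≤ E k.2.2 / r k.1 k.2.2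
  have hRm : Measurable R := by
    refine measurable_pi_iff.2 fun k => measurableSet_setOfPred.1 ?_
    exact measurableSet_le (by fun_prop) (by fun_prop)
  obtain ⟨N, ⟨e⟩⟩ := Finite.exists_equiv_fin (Set.range R)
  let T : (𝒴 → ℝ) → Fin N := fun E => e ⟨R E, E, rfl⟩
  have hT : ∀ c, MeasurableSet (T ⁻¹' {c}) := by
    intro c
    have : T ⁻¹' {c} = R ⁻¹' {(e.symm c).1} := by
      ext E
      simp only [Set.mem_preimage, Set.mem_singleton_iff, T]
      rw [← Equiv.eq_symm_apply, Subtype.ext_iff]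
    rw [this]
    exact hRm (measurableSet_singleton _)
  choose rep hrep using fun c => (e.symm c).2
  have hTrep : ∀ E, R (rep (T E)) = R E := by
    intro E
    rw [hrep]
    simp [T]
  have hwin : ∀ c s, ∃ y, 0 < p s y ∧
      ∀ i, 0 < p s i → rep c y / p s y ≤ rep c i / p s i := by
    intro c s
    have hne : (Finset.univ.filter fun i => 0 < p s i).Nonempty := by
      by_contra h
      rw [Finset.not_nonempty_iff_eq_empty, Finset.filter_eq_empty_iff] at h
      have h1 := hp1 s
      rw [Finset.sum_eq_zero fun i hi => le_antisymm (not_lt.1 (h hi)) (hp0 s i)] at h1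
      exact zero_ne_one h1
    obtain ⟨y, hy, hmin⟩ := Finset.exists_min_image _ (fun i => rep c i / p s i) hne
    exact ⟨y, (Finset.mem_filter.1 hy).2, fun i hi => hmin i (by simpa using hi)⟩
  choose f hf0 hfmin using hwin
  have hfT : ∀ E s y, f (T E) s = y → ∀ i, 0 < p s i → E y / p s y ≤ E i / p s i := by
    rintro E s y rfl i hi
    have h := congrFun (hTrep E) (some s, f (T E) s, i)
    exact h.mp (hfmin (T E) s i hi)
  have hvT : ∀ E y j, rep (T E) j / q j ≤ rep (T E) y / q y ↔ E j / q j ≤ E y / q y :=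
    fun E y j => iff_of_eq (congrFun (hTrep E) (none, j, y))
  have hle : ∀ s y, ρ.real {E | f (T E) s = y} ≤ p s y := by
    intro s y
    rcases (hp0 s y).eq_or_lt with h | h
    · have : {E | f (T E) s = y} = ∅ := by
        ext E
        simp only [Set.mem_ofPred_eq, Set.mem_empty_iff_false, iff_false]
        rintro rfl
        exact absurd h (hf0 _ _).ne
      simp [this, ← h]
    · refine ENNReal.toReal_le_of_le_ofReal h.le
        ((measure_mono fun E hE => ?_).trans (race_winner_le (hp0 s) (hp1 s) h))
      exact hfT E s y hE
  have hw1 : ∑ c, ρ.real (T ⁻¹' {c}) = 1 := by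
    simpa using sum_ite_measureReal_fiber ρ hT fun _ => True
  refine ⟨N, fun c => ρ.real (T ⁻¹' {c}), f, fun c y => rep c y / q y,
    fun c => measureReal_nonneg, hw1, hf0, ?_, ?_⟩
  · intro s y
    have hsum : ∑ y, ∑ c, (if f c s = y then ρ.real (T ⁻¹' {c}) else 0) = ∑ y, p s y := by
      rw [Finset.sum_comm, hp1, ← hw1]
      simp
    have hle' : ∀ y ∈ Finset.univ,
        ∑ c, (if f c s = y then ρ.real (T ⁻¹' {c}) else 0) ≤ p s y := by
      intro y _
      rw [sum_ite_measureReal_fiber ρ hT fun c => f c s = y]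
      exact hle s y
    exact (Finset.sum_eq_sum_iff_of_le hle').1 hsum y (Finset.mem_univ y)
  · intro s y hqy
    calc ∑ c, (if f c s = y then ρ.real (T ⁻¹' {c}) *
          ((Finset.univ.filter fun j => 0 < q j).filter
            fun j => rep c j / q j ≤ rep c y / q y).card else 0)
        = ∑ j, ∑ c, (if f c s = y ∧ 0 < q j ∧ rep c j / q j ≤ rep c y / q y
            then ρ.real (T ⁻¹' {c}) else 0) := by
          rw [Finset.sum_comm]
          refine Finset.sum_congr rfl fun c _ => ?_
          split_ifs with h
          · simp only [h, true_and]
            rw [Finset.filter_filter, ← Finset.sum_filter, Finset.sum_const, nsmul_eq_mul,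
              mul_comm]
          · simp [h]
      _ ≤ ∑ j, ((if j = y then p s y else 0) + p s y ^ 2 / q y * q j) := by
          refine Finset.sum_le_sum fun j _ => ?_
          rw [sum_ite_measureReal_fiber ρ hT fun c =>
            f c s = y ∧ 0 < q j ∧ rep c j / q j ≤ rep c y / q y]
          split_ifs with hj
          · have h1 : ρ.real {E | f (T E) s = y ∧ 0 < q j ∧
                rep (T E) j / q j ≤ rep (T E) y / q y} ≤ p s y :=
              (measureReal_mono fun E hE => hE.1).trans (hle s y)
            have h2 : 0 ≤ p s y ^ 2 / q y * q j := by have := hq0 j; positivity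
            linarith
          · rw [zero_add]
            rcases (hq0 j).eq_or_lt with h | h
            · simp [← h]
            rcases (hp0 s y).eq_or_lt with h' | h'
            · have : ρ.real {E | f (T E) s = y ∧ 0 < q j ∧
                rep (T E) j / q j ≤ rep (T E) y / q y} ≤ p s y :=
                (measureReal_mono fun E hE => hE.1).trans (hle s y)
              simpa [← h'] using this
            · refine ENNReal.toReal_le_of_le_ofReal (by positivity)
                (((measure_mono fun E hE => ?_).trans (race_winner_overtaken_le (hp0 s) (hp1 s)
                  h' hj hqy h)).trans_eq (by congr 1; ring))
              exact ⟨hfT E s y hE.1, (hvT E y j).1 hE.2.2⟩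
      _ = p s y * (1 + p s y / q y) := by
          rw [Finset.sum_add_distrib, ← Finset.mul_sum, hq1]
          simp only [Finset.sum_ite_eq', Finset.mem_univ, if_true]
          ring

/-- Elements of a finite set with a real score: the ranks, counted with ties, are at least as
spread out as `1, 2, …, |T|`. -/
lemma sum_antitone_rank_le {ι : Type*} [DecidableEq ι] (T : Finset ι) (v : ι → ℝ) {g : ℕ → ℝ}
    (hg : Antitone g) :
    ∑ y ∈ T, g ((T.filter fun j => v j ≤ v y).card) ≤ ∑ k ∈ Finset.range T.card, g (k + 1) := by
  induction T using Finset.induction_on_max_value v with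
  | empty => simp
  | insert a s ha hmax ih =>
    rw [Finset.sum_insert ha, Finset.card_insert_of_notMem ha, Finset.sum_range_succ, add_comm]
    refine add_le_add (le_trans (Finset.sum_le_sum fun y _ => hg ?_) ih) ?_
    · exact Finset.card_le_card (Finset.filter_subset_filter _ (Finset.subset_insert _ _))
    · rw [Finset.filter_true_of_mem, Finset.card_insert_of_notMem ha]
      intro j hj
      rcases Finset.mem_insert.1 hj with rfl | h
      exacts [le_rfl, hmax j h]

lemma rpow_neg_one_add_le {a : ℝ} (ha : 0 < a) {k : ℕ} (hk : 1 ≤ k) :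
    ((k + 1 : ℕ) : ℝ) ^ (-(1 + a)) ≤ (1 / a) * ((k : ℝ) ^ (-a) - ((k + 1 : ℕ) : ℝ) ^ (-a)) := by
  have hk0 : (0 : ℝ) < k := by exact_mod_cast hk
  push_cast
  set x : ℝ := k + 1 with hx
  have hx0 : 0 < x := by positivity
  have h1 : (k : ℝ) ^ (-a) = x ^ (-a) * ((k : ℝ) / x) ^ (-a) := by
    rw [← Real.mul_rpow hx0.le (by positivity)]
    congr 1; field_simp
  have h2 : 1 + a / x ≤ ((k : ℝ) / x) ^ (-a) := by
    rw [Real.rpow_def_of_pos (by positivity)]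
    have hlog : Real.log (k / x) ≤ -(1 / x) := by
      have := Real.log_le_sub_one_of_pos (x := k / x) (by positivity)
      have h3 : (k : ℝ) / x - 1 = -(1 / x) := by rw [hx]; field_simp; ring
      linarith
    have := Real.add_one_le_exp (Real.log (k / x) * -a)
    have h4 : a / x ≤ Real.log (k / x) * -a := by
      calc a / x = -(1 / x) * -a := by ring
        _ ≤ _ := mul_le_mul_of_nonpos_right hlog (by linarith)
    linarith
  have h5 : x ^ (-(1 + a)) = x ^ (-a) / x := by
    rw [neg_add', show -1 - a = -a - 1 by ring, Real.rpow_sub_one hx0.ne']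
  rw [h5, h1]
  have hpos : 0 < x ^ (-a) := by positivity
  calc x ^ (-a) / x = 1 / a * (x ^ (-a) * (1 + a / x) - x ^ (-a)) := by field_simp; ring
    _ ≤ _ := by gcongr

lemma sum_rpow_neg_one_add_le {a : ℝ} (ha : 0 < a) (n : ℕ) :
    ∑ k ∈ Finset.range n, ((k + 1 : ℕ) : ℝ) ^ (-(1 + a)) ≤ 1 + 1 / a := by
  have key : ∀ n : ℕ, ∑ k ∈ Finset.range (n + 1), ((k + 1 : ℕ) : ℝ) ^ (-(1 + a))
      ≤ 1 + 1 / a * (1 - ((n + 1 : ℕ) : ℝ) ^ (-a)) := by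
    intro n
    induction n with
    | zero => simp
    | succ n ih =>
      rw [Finset.sum_range_succ]
      have := rpow_neg_one_add_le ha (Nat.succ_le_succ (Nat.zero_le n))
      simp only [Nat.succ_eq_add_one] at this
      linarith
  rcases n with _ | n
  · simp; positivity
  · refine (key n).trans ?_
    have : 0 ≤ ((n + 1 : ℕ) : ℝ) ^ (-a) := by positivity
    have h2 : 1 / a * (1 - ((n + 1 : ℕ) : ℝ) ^ (-a)) ≤ 1 / a * 1 := by gcongr; linarith
    linarith

lemma sum_negMulLog_le_cross {𝒴 : Type*} [Fintype 𝒴] {r : 𝒴 → ℝ} (hr0 : ∀ y, 0 ≤ r y)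
    (hr1 : ∑ y, r y = 1) {T : Finset 𝒴} (hrT : ∀ y, 0 < r y → y ∈ T) {Q : 𝒴 → ℝ}
    (hQ : ∀ y ∈ T, 0 < Q y) {Z : ℝ} (hZ : 0 < Z) (hQZ : ∑ y ∈ T, Q y ≤ Z) :
    ∑ y, Real.negMulLog (r y) ≤ Real.log Z + ∑ y, r y * -Real.log (Q y) := by
  classical
  have hpt : ∀ y, Real.negMulLog (r y) ≤ r y * Real.log Z + r y * -Real.log (Q y)
      + ((if y ∈ T then Q y else 0) / Z - r y) := by
    intro y
    rcases (hr0 y).eq_or_lt with h | h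
    · rw [← h]
      split_ifs with hy
      · have := hQ y hy
        simp only [Real.negMulLog_zero, zero_mul, zero_add, sub_zero]
        positivity
      · simp
    · have hy := hrT y h
      have hQy := hQ y hy
      rw [if_pos hy]
      have hlog := Real.log_le_sub_one_of_pos (x := Q y / Z / r y) (by positivity)
      rw [Real.log_div (by positivity) h.ne', Real.log_div hQy.ne' hZ.ne'] at hlog
      have := mul_le_mul_of_nonneg_left hlog h.le
      have h2 : r y * (Q y / Z / r y - 1) = Q y / Z - r y := by field_simp
      rw [h2] at this
      rw [Real.negMulLog]
      linarith
  refine (Finset.sum_le_sum fun y _ => hpt y).trans ?_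
  rw [Finset.sum_add_distrib, Finset.sum_add_distrib, ← Finset.sum_mul, hr1,
    Finset.sum_sub_distrib, ← Finset.sum_div, hr1, Finset.sum_ite_mem, Finset.univ_inter]
  have : (∑ y ∈ T, Q y) / Z ≤ 1 := (div_le_one hZ).2 hQZ
  linarith

lemma sum_ite_mul_log_le {ι : Type*} [Fintype ι] {φ : ι → Prop} [DecidablePred φ] {w K : ι → ℝ}
    (hw : ∀ c, 0 ≤ w c) (hK : ∀ c, φ c → 0 < K c) {P a : ℝ} (ha : 0 < a)
    (hP : ∑ c, (if φ c then w c else 0) = P)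
    (hPK : ∑ c, (if φ c then w c * K c else 0) ≤ P * a) :
    ∑ c, (if φ c then w c * Real.log (K c) else 0) ≤ P * Real.log a := by
  have hpt : ∀ c, (if φ c then w c * Real.log (K c) else 0) ≤
      (if φ c then w c else 0) * (Real.log a - 1) + (if φ c then w c * K c else 0) / a := by
    intro c
    split_ifs with h
    · have hlog := Real.log_le_sub_one_of_pos (x := K c / a) (by have := hK c h; positivity)
      rw [Real.log_div (hK c h).ne' ha.ne'] at hlog
      have := mul_le_mul_of_nonneg_left hlog (hw c)
      have h2 : w c * K c / a = w c * (K c / a) := by ring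
      rw [h2]
      linarith
    · simp
  refine (Finset.sum_le_sum fun c _ => hpt c).trans ?_
  rw [Finset.sum_add_distrib, ← Finset.sum_mul, ← Finset.sum_div, hP]
  have : (∑ c, (if φ c then w c * K c else 0)) / a ≤ P := (div_le_iff₀ ha).2 hPK
  linarith

lemma sum_mul_log_one_add_div_le {𝒴 : Type*} [Fintype 𝒴] {p q : 𝒴 → ℝ} (hp0 : ∀ y, 0 ≤ p y)
    (hp1 : ∑ y, p y = 1) (hq0 : ∀ y, 0 ≤ q y) (hq1 : ∑ y, q y = 1)
    (hpq : ∀ y, 0 < p y → 0 < q y) :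
    ∑ y, p y * Real.log (1 + p y / q y) ≤ ∑ y, p y * Real.log (p y / q y) + Real.log 2 := by
  have hpt : ∀ y, p y * Real.log (1 + p y / q y) ≤
      p y * Real.log (p y / q y) + p y * Real.log 2 + (q y - p y) / 2 := by
    intro y
    rcases (hp0 y).eq_or_lt with h | h
    · have := hq0 y
      rw [← h]; simp; linarith
    · have hq := hpq y h
      have hlog := Real.log_le_sub_one_of_pos (x := (1 + q y / p y) / 2) (by positivity)
      rw [Real.log_div (by positivity) two_ne_zero] at hlog
      have he : 1 + p y / q y = p y / q y * (1 + q y / p y) := by field_simp; ring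
      have := mul_le_mul_of_nonneg_left hlog h.le
      have h2 : p y * ((1 + q y / p y) / 2 - 1) = (q y - p y) / 2 := by field_simp; ring
      rw [he, Real.log_mul (by positivity) (by positivity)]
      linarith
  refine (Finset.sum_le_sum fun y _ => hpt y).trans ?_
  rw [Finset.sum_add_distrib, Finset.sum_add_distrib, ← Finset.sum_mul, ← Finset.sum_div,
    Finset.sum_sub_distrib, hp1, hq1]
  linarith

/-- Strong functional representation lemma, with a finite auxiliary variable. Here `a` is the law
of `S`, `p s` the conditional law of `Y` given `S = s` and `q` the law of `Y`; the auxiliary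
variable `c` has law `w`, and `Y = f c S`. The last conjunct bounds `H(Y|c)`. -/
lemma exists_strong_functional_representation {𝒮 𝒴 : Type*} [Fintype 𝒮] [Fintype 𝒴]
    [DecidableEq 𝒴] {a : 𝒮 → ℝ} (ha0 : ∀ s, 0 ≤ a s) (ha1 : ∑ s, a s = 1) {p : 𝒮 → 𝒴 → ℝ}
    (hp0 : ∀ s y, 0 ≤ p s y) (hp1 : ∀ s, ∑ y, p s y = 1) {q : 𝒴 → ℝ} (hq0 : ∀ y, 0 ≤ q y)
    (hq1 : ∑ y, q y = 1) (hpq : ∀ s y, 0 < p s y → 0 < q y) {I : ℝ} (hI0 : 0 ≤ I)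
    (hI : ∑ s, a s * ∑ y, p s y * Real.log (p s y / q y) = I * Real.log 2) :
    ∃ (N : ℕ) (w : Fin N → ℝ) (f : Fin N → 𝒮 → 𝒴), (∀ c, 0 ≤ w c) ∧ ∑ c, w c = 1 ∧
      (∀ s y, ∑ c, (if f c s = y then w c else 0) = p s y) ∧
      ∑ c, w c * ∑ y, Real.negMulLog (∑ s, if f c s = y then a s else 0)
        ≤ Real.log 2 * (I + (Real.logb 2 (I + 1) + 4)) := by
  obtain ⟨N, w, f, v, hw0, hw1, hf, hfp, hK⟩ := exists_exponential_race hp0 hp1 hq0 hq1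
  refine ⟨N, w, f, hw0, hw1, hfp, ?_⟩
  set T : Finset 𝒴 := Finset.univ.filter fun j => 0 < q j with hT
  set K : Fin N → 𝒴 → ℕ := fun c y => (T.filter fun j => v c j ≤ v c y).card
  have hlog2 : 0 < Real.log 2 := Real.log_pos one_lt_two
  have hK1 : ∀ c, ∀ y ∈ T, 1 ≤ K c y := fun c y hy =>
    Finset.card_pos.2 ⟨y, Finset.mem_filter.2 ⟨hy, le_rfl⟩⟩
  have hfT : ∀ c s, f c s ∈ T := fun c s => by simpa [hT] using hpq s _ (hf c s)
  set b : ℝ := 1 / (I + 1) with hb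
  have hb0 : 0 < b := by positivity
  have hentropy : ∀ c, ∑ y, Real.negMulLog (∑ s, if f c s = y then a s else 0)
      ≤ Real.log (1 + 1 / b) + (1 + b) * ∑ s, a s * Real.log (K c (f c s)) := by
    intro c
    set g : ℕ → ℝ := fun k => ((max k 1 : ℕ) : ℝ) ^ (-(1 + b)) with hg
    have hganti : Antitone g := by
      intro i j hij
      refine Real.rpow_le_rpow_of_nonpos ?_ ?_ (by linarith)
      · exact_mod_cast lt_of_lt_of_le one_pos (le_max_right i 1)
      · exact_mod_cast max_le_max_right 1 hij
    have hgpos : ∀ k, 0 < g k := by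
      intro k
      refine Real.rpow_pos_of_pos ?_ _
      exact_mod_cast lt_of_lt_of_le one_pos (le_max_right k 1)
    have hsum : ∑ y ∈ T, g (K c y) ≤ 1 + 1 / b := by
      refine (sum_antitone_rank_le T (v c) hganti).trans
        (le_trans (le_of_eq ?_) (sum_rpow_neg_one_add_le hb0 T.card))
      refine Finset.sum_congr rfl fun k _ => ?_
      simp [hg]
    have hr0 : ∀ y, 0 ≤ ∑ s, if f c s = y then a s else 0 := fun y =>
      Finset.sum_nonneg fun s _ => by split_ifs; exacts [ha0 s, le_rfl]
    have hr1 : ∑ y, ∑ s, (if f c s = y then a s else 0) = 1 := by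
      rw [Finset.sum_comm]; simpa using ha1
    have hrT : ∀ y, (0 < ∑ s, if f c s = y then a s else 0) → y ∈ T := by
      intro y hy
      obtain ⟨s, -, hs⟩ := Finset.exists_ne_zero_of_sum_ne_zero hy.ne'
      have : f c s = y := by
        by_contra h
        simp [h] at hs
      exact this ▸ hfT c s
    refine (sum_negMulLog_le_cross hr0 hr1 hrT (fun y _ => hgpos (K c y)) (by positivity)
      hsum).trans ?_
    gcongr
    rw [Finset.mul_sum]
    simp_rw [Finset.sum_mul]
    rw [Finset.sum_comm]
    refine Finset.sum_le_sum fun s _ => le_of_eq ?_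
    simp only [ite_mul, zero_mul, Finset.sum_ite_eq, Finset.mem_univ, if_true]
    have h1 := hK1 c _ (hfT c s)
    simp only [hg, max_eq_left h1]
    rw [Real.log_rpow (by exact_mod_cast h1)]
    ring
  have hlogK : ∀ s, ∑ c, w c * Real.log (K c (f c s))
      ≤ ∑ y, p s y * Real.log (p s y / q y) + Real.log 2 := by
    intro s
    refine le_trans ?_ (sum_mul_log_one_add_div_le (hp0 s) (hp1 s) hq0 hq1 (hpq s))
    calc ∑ c, w c * Real.log (K c (f c s))
        = ∑ y, ∑ c, (if f c s = y then w c * Real.log (K c y) else 0) := by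
          rw [Finset.sum_comm]
          simp
      _ ≤ _ := Finset.sum_le_sum fun y _ => ?_
    by_cases hy : 0 < q y
    · have hyT : y ∈ T := by simpa [hT] using hy
      have := hp0 s y
      exact sum_ite_mul_log_le hw0 (fun c _ => by exact_mod_cast hK1 c y hyT) (by positivity)
        (hfp s y) (hK s y hy)
    · rw [Finset.sum_eq_zero, (le_antisymm (not_lt.1 fun h => hy (hpq s y h)) (hp0 s y) : p s y = 0)]
      · simp
      · intro c _
        rw [if_neg]
        rintro rfl
        exact hy (hpq s _ (hf c s))
  have hmean : ∑ c, w c * ∑ s, a s * Real.log (K c (f c s)) ≤ (I + 1) * Real.log 2 := by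
    calc ∑ c, w c * ∑ s, a s * Real.log (K c (f c s))
        = ∑ s, a s * ∑ c, w c * Real.log (K c (f c s)) := by
          simp_rw [Finset.mul_sum]
          rw [Finset.sum_comm]
          exact Finset.sum_congr rfl fun _ _ => Finset.sum_congr rfl fun _ _ => by ring
      _ ≤ ∑ s, a s * (∑ y, p s y * Real.log (p s y / q y) + Real.log 2) :=
          Finset.sum_le_sum fun s _ => mul_le_mul_of_nonneg_left (hlogK s) (ha0 s)
      _ = (I + 1) * Real.log 2 := by
          simp_rw [mul_add]
          rw [Finset.sum_add_distrib, hI, ← Finset.sum_mul, ha1]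
          ring
  have hlogI : Real.log (I + 2) ≤ Real.log 2 + Real.log (I + 1) := by
    rw [← Real.log_mul two_ne_zero (by positivity)]
    exact Real.log_le_log (by positivity) (by linarith)
  calc ∑ c, w c * ∑ y, Real.negMulLog (∑ s, if f c s = y then a s else 0)
      ≤ ∑ c, w c * (Real.log (1 + 1 / b) + (1 + b) * ∑ s, a s * Real.log (K c (f c s))) :=
        Finset.sum_le_sum fun c _ => mul_le_mul_of_nonneg_left (hentropy c) (hw0 c)
    _ = Real.log (I + 2) + (1 + b) * ∑ c, w c * ∑ s, a s * Real.log (K c (f c s)) := by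
        simp_rw [mul_add]
        rw [Finset.sum_add_distrib, ← Finset.sum_mul, hw1, one_mul, Finset.mul_sum,
          show 1 + 1 / b = I + 2 by rw [hb, one_div_one_div]; ring]
        congr 1
        exact Finset.sum_congr rfl fun _ _ => by ring
    _ ≤ Real.log 2 + Real.log (I + 1) + (1 + b) * ((I + 1) * Real.log 2) := by gcongr
    _ = Real.log (I + 1) + Real.log 2 * (I + 3) := by
        rw [hb]; field_simp; ring
    _ ≤ _ := by
        rw [Real.logb]
        simp only [mul_add]
        rw [mul_div_cancel₀ _ hlog2.ne']
        linarith

section FiniteEntropy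

lemma ent_eq_sum_negMulLog {Ω : Type*} [MeasurableSpace Ω] (μ : Measure Ω) {𝒳 : Type*}
    [Fintype 𝒳] (X : Ω → 𝒳) : ent μ X = (∑ x, Real.negMulLog (pm μ X x)) / Real.log 2 := by
  rw [ent, Finset.sum_div, ← Finset.sum_neg_distrib]
  refine Finset.sum_congr rfl fun x _ => ?_
  rw [Real.logb, Real.negMulLog]
  ring

lemma pm_nonneg {Ω : Type*} [MeasurableSpace Ω] (μ : Measure Ω) {𝒳 : Type*} (X : Ω → 𝒳) (x : 𝒳) :
    0 ≤ pm μ X x := ENNReal.toReal_nonneg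

lemma ent_prod_swap {Ω : Type*} [MeasurableSpace Ω] (μ : Measure Ω) {𝒳 𝒴 : Type*} [Fintype 𝒳]
    [Fintype 𝒴] (X : Ω → 𝒳) (Y : Ω → 𝒴) :
    ent μ (fun ω => (Y ω, X ω)) = ent μ (fun ω => (X ω, Y ω)) := by
  rw [ent_eq_sum_negMulLog, ent_eq_sum_negMulLog]
  congr 1
  refine Fintype.sum_equiv (Equiv.prodComm 𝒴 𝒳) _ _ fun z => ?_
  have : (fun ω => (Y ω, X ω)) ⁻¹' {z} = (fun ω => (X ω, Y ω)) ⁻¹' {Equiv.prodComm 𝒴 𝒳 z} := by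
    ext ω
    simp [Prod.ext_iff, and_comm]
  rw [pm, pm, this]

lemma sum_pm_eq_measureReal {Ω : Type*} [MeasurableSpace Ω] (μ : Measure Ω) [IsProbabilityMeasure μ]
    {𝒴 : Type*} [Fintype 𝒴] [MeasurableSpace 𝒴] [MeasurableSingletonClass 𝒴] {Y : Ω → 𝒴}
    (hY : Measurable Y) {s : Set Ω} (hs : MeasurableSet s) :
    ∑ y, μ.real (s ∩ Y ⁻¹' {y}) = μ.real s := by
  rw [← measureReal_biUnion_finset]
  · congr 1
    ext ω
    simp
  · intro a _ b _ hab
    exact ((Set.disjoint_singleton.2 hab).preimage Y).mono Set.inter_subset_right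
      Set.inter_subset_right
  · exact fun y _ => hs.inter (hY (measurableSet_singleton y))

lemma sum_pm {Ω : Type*} [MeasurableSpace Ω] (μ : Measure Ω) [IsProbabilityMeasure μ]
    {𝒴 : Type*} [Fintype 𝒴] [MeasurableSpace 𝒴] [MeasurableSingletonClass 𝒴] {Y : Ω → 𝒴}
    (hY : Measurable Y) : ∑ y, pm μ Y y = 1 := by
  have := sum_pm_eq_measureReal μ hY MeasurableSet.univ
  simpa [pm, Measure.real] using this

section Marginals

variable {Ω : Type*} [MeasurableSpace Ω] (μ : Measure Ω) [IsProbabilityMeasure μ] {𝒮 𝒴 : Type*}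
  [MeasurableSpace 𝒮] [MeasurableSingletonClass 𝒮] [MeasurableSpace 𝒴]
  [MeasurableSingletonClass 𝒴] {S : Ω → 𝒮} {Y : Ω → 𝒴}

lemma sum_pm_prod_right [Fintype 𝒴] (hS : Measurable S) (hY : Measurable Y) (s : 𝒮) :
    ∑ y, pm μ (fun ω => (S ω, Y ω)) (s, y) = pm μ S s := by
  rw [show pm μ S s = _ from (sum_pm_eq_measureReal μ hY (hS (measurableSet_singleton s))).symm]
  refine Finset.sum_congr rfl fun y _ => ?_
  rw [pm, Measure.real]
  congr 2
  ext ω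
  simp [Prod.ext_iff]

lemma sum_pm_prod_left [Fintype 𝒮] (hS : Measurable S) (hY : Measurable Y) (y : 𝒴) :
    ∑ s, pm μ (fun ω => (S ω, Y ω)) (s, y) = pm μ Y y := by
  rw [← sum_pm_prod_right μ hY hS y]
  refine Finset.sum_congr rfl fun s _ => ?_
  rw [pm, pm]
  congr 2
  ext ω
  simp [Prod.ext_iff, and_comm]

lemma condEnt_nonneg [Fintype 𝒮] [Fintype 𝒴] (hS : Measurable S) (hY : Measurable Y) :
    0 ≤ condEnt μ S Y := by
  rw [condEnt, ent_eq_sum_negMulLog, ent_eq_sum_negMulLog, ← sub_div]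
  refine div_nonneg (sub_nonneg.2 ?_) (Real.log_pos one_lt_two).le
  rw [Fintype.sum_prod_type_right]
  refine Finset.sum_le_sum fun y _ => ?_
  have hsum := sum_pm_prod_left μ hS hY y
  rw [Real.negMulLog, neg_mul, ← mul_neg, ← hsum, Finset.sum_mul]
  refine Finset.sum_le_sum fun s _ => ?_
  rcases (pm_nonneg μ (fun ω => (S ω, Y ω)) (s, y)).eq_or_lt with h | h
  · simp [← h]
  · have hle : pm μ (fun ω => (S ω, Y ω)) (s, y) ≤ ∑ s, pm μ (fun ω => (S ω, Y ω)) (s, y) :=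
      Finset.single_le_sum (f := fun s => pm μ (fun ω => (S ω, Y ω)) (s, y))
        (fun s _ => pm_nonneg μ _ _) (Finset.mem_univ s)
    rw [Real.negMulLog, neg_mul, ← mul_neg]
    gcongr

end Marginals

/-- The law on a finite type with the given weights. -/
def finLaw {Ω : Type*} [Fintype Ω] [MeasurableSpace Ω] (ρ : Ω → ℝ) : Measure Ω :=
  ∑ x, ENNReal.ofReal (ρ x) • Measure.dirac x

variable {Ω : Type*} [Fintype Ω] [MeasurableSpace Ω]

lemma isProbabilityMeasure_finLaw {ρ : Ω → ℝ} (h0 : ∀ x, 0 ≤ ρ x) (h1 : ∑ x, ρ x = 1) :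
    IsProbabilityMeasure (finLaw ρ) := by
  constructor
  simp [finLaw, ← ENNReal.ofReal_sum_of_nonneg fun x _ => h0 x, h1]

lemma pm_finLaw [DiscreteMeasurableSpace Ω] {ρ : Ω → ℝ} (h0 : ∀ x, 0 ≤ ρ x) {𝒳 : Type*} [DecidableEq 𝒳] (X : Ω → 𝒳) (z : 𝒳) :
    pm (finLaw ρ) X z = ∑ x, if X x = z then ρ x else 0 := by
  rw [pm, finLaw, Measure.finsetSum_apply, ENNReal.toReal_sum]
  · refine Finset.sum_congr rfl fun x _ => ?_
    by_cases h : X x = z <;> simp [h, h0 x, Measure.dirac_apply' _ (MeasurableSet.of_discrete)]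
  · intro x _
    exact (ENNReal.mul_lt_top ENNReal.ofReal_lt_top (measure_lt_top _ _)).ne

/-- Weights of the product law of `w`, `a` and a Bernoulli variable of parameter `α`. -/
def erasureWeight {C J : Type*} (w : C → ℝ) (a : J → ℝ) (α : ℝ) (x : C × J × Bool) : ℝ :=
  w x.1 * a x.2.1 * bif x.2.2 then α else 1 - α

/-- Reveals the second coordinate exactly when the flag is `true`. -/
def erasure {C J : Type*} (x : C × J × Bool) : C × Option J :=
  (x.1, bif x.2.2 then some x.2.1 else none)

variable {C J : Type*} {w : C → ℝ} {a : J → ℝ} {α : ℝ}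

lemma erasureWeight_nonneg (hw : ∀ c, 0 ≤ w c) (ha : ∀ i, 0 ≤ a i) (hα0 : 0 ≤ α) (hα1 : α ≤ 1)
    (x : C × J × Bool) : 0 ≤ erasureWeight w a α x := by
  obtain ⟨c, i, b⟩ := x
  have := hw c
  have := ha i
  have : 0 ≤ 1 - α := by linarith
  cases b <;> simp only [erasureWeight, cond_true, cond_false] <;> positivity

variable [Fintype C] [Fintype J]

lemma sum_erasureWeight (hw : ∑ c, w c = 1) (ha : ∑ i, a i = 1) :
    ∑ x, erasureWeight w a α x = 1 := by
  simp only [Fintype.sum_prod_type, erasureWeight, Fintype.sum_bool, cond_true, cond_false]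
  simp_rw [← mul_add, add_sub_cancel, mul_one, ← Finset.mul_sum, ha, mul_one, hw]

variable [MeasurableSpace C] [DiscreteMeasurableSpace C] [MeasurableSpace J]
  [DiscreteMeasurableSpace J]

lemma pm_erasure_law (hρ : ∀ x, 0 ≤ erasureWeight w a α x) {𝒵 : Type*} [DecidableEq 𝒵]
    (h : C → J → 𝒵) (z : 𝒵) :
    pm (finLaw (erasureWeight w a α)) (fun x => h x.1 x.2.1) z
      = ∑ c, w c * ∑ i, if h c i = z then a i else 0 := by
  rw [pm_finLaw hρ]
  simp only [Fintype.sum_prod_type, erasureWeight, Fintype.sum_bool, cond_true, cond_false]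
  refine Finset.sum_congr rfl fun c _ => ?_
  rw [Finset.mul_sum]
  refine Finset.sum_congr rfl fun i _ => ?_
  split_ifs <;> ring

lemma ent_erasure_prod (hρ : ∀ x, 0 ≤ erasureWeight w a α x) (ha : ∑ i, a i = 1)
    {𝒵 : Type*} [Fintype 𝒵] [DecidableEq 𝒵] (h : C → J → 𝒵) :
    ent (finLaw (erasureWeight w a α)) (fun x => (erasure x, h x.1 x.2.1))
      = ent (finLaw (erasureWeight w a α)) erasure + (1 - α) *
        (∑ c, w c * ∑ z, Real.negMulLog (∑ i, if h c i = z then a i else 0)) / Real.log 2 := by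
  classical
  have hU0 : ∀ c, pm (finLaw (erasureWeight w a α)) erasure (c, none) = w c * (1 - α) := by
    intro c
    rw [pm_finLaw hρ]
    simp [Fintype.sum_prod_type, erasureWeight, erasure, ite_and]
    rw [← Finset.sum_mul, ← Finset.mul_sum, ha, mul_one]
  have hU1 : ∀ c i, pm (finLaw (erasureWeight w a α)) erasure (c, some i) = w c * a i * α := by
    intro c i
    rw [pm_finLaw hρ]
    simp [Fintype.sum_prod_type, erasureWeight, erasure, ite_and]
  have hV0 : ∀ c z, pm (finLaw (erasureWeight w a α)) (fun x => (erasure x, h x.1 x.2.1))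
      ((c, none), z) = w c * (1 - α) * ∑ i, if h c i = z then a i else 0 := by
    intro c z
    rw [pm_finLaw hρ]
    simp [Fintype.sum_prod_type, erasureWeight, erasure, ite_and]
    rw [Finset.mul_sum]
    refine Finset.sum_congr rfl fun i _ => ?_
    split_ifs <;> ring
  have hV1 : ∀ c i z, pm (finLaw (erasureWeight w a α)) (fun x => (erasure x, h x.1 x.2.1))
      ((c, some i), z) = if h c i = z then w c * a i * α else 0 := by
    intro c i z
    rw [pm_finLaw hρ]
    simp [Fintype.sum_prod_type, erasureWeight, erasure, ite_and]
  have hz : ∀ c, ∑ z, ∑ i, (if h c i = z then a i else 0) = 1 := by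
    intro c
    rw [Finset.sum_comm]
    simpa using ha
  rw [ent_eq_sum_negMulLog, ent_eq_sum_negMulLog, ← add_div]
  congr 1
  simp only [Fintype.sum_prod_type, Fintype.sum_option, hU0, hU1, hV0, hV1]
  rw [Finset.mul_sum, ← Finset.sum_add_distrib]
  refine Finset.sum_congr rfl fun c _ => ?_
  simp_rw [Real.negMulLog_mul (w c * (1 - α)), apply_ite Real.negMulLog, Real.negMulLog_zero,
    Finset.sum_add_distrib, ← Finset.sum_mul, hz, ← Finset.mul_sum]
  simp only [Finset.sum_ite_eq, Finset.mem_univ, if_true]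
  ring

end FiniteEntropy

/-- Conditional laws `p s` of `Y` given `S = s`, with the mutual information as an average
divergence from the law of `Y`. -/
lemma exists_conditional_law {Ω : Type*} [MeasurableSpace Ω] (μ : Measure Ω)
    [IsProbabilityMeasure μ] {𝒮 𝒴 : Type*} [Fintype 𝒮] [MeasurableSpace 𝒮]
    [MeasurableSingletonClass 𝒮] [Fintype 𝒴] [MeasurableSpace 𝒴] [MeasurableSingletonClass 𝒴]
    {S : Ω → 𝒮} {Y : Ω → 𝒴} (hS : Measurable S) (hY : Measurable Y) :
    ∃ p : 𝒮 → 𝒴 → ℝ, (∀ s y, 0 ≤ p s y) ∧ (∀ s, ∑ y, p s y = 1) ∧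
      (∀ s y, 0 < p s y → 0 < pm μ Y y) ∧
      (∀ s y, pm μ S s * p s y = pm μ (fun ω => (S ω, Y ω)) (s, y)) ∧
      ∑ s, pm μ S s * ∑ y, p s y * Real.log (p s y / pm μ Y y) = mi μ S Y * Real.log 2 := by
  classical
  set P : 𝒮 → 𝒴 → ℝ := fun s y => pm μ (fun ω => (S ω, Y ω)) (s, y) with hP
  have hP0 : ∀ s y, 0 ≤ P s y := fun s y => pm_nonneg μ _ _
  have hPS : ∀ s, ∑ y, P s y = pm μ S s := sum_pm_prod_right μ hS hY
  have hPY : ∀ y, ∑ s, P s y = pm μ Y y := sum_pm_prod_left μ hS hY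
  have hleS : ∀ s y, P s y ≤ pm μ S s := fun s y =>
    hPS s ▸ Finset.single_le_sum (f := fun y => P s y) (fun y _ => hP0 s y) (Finset.mem_univ y)
  have hleY : ∀ s y, P s y ≤ pm μ Y y := fun s y =>
    hPY y ▸ Finset.single_le_sum (f := fun s => P s y) (fun s _ => hP0 s y) (Finset.mem_univ s)
  let p : 𝒮 → 𝒴 → ℝ := fun s y => if pm μ S s = 0 then pm μ Y y else P s y / pm μ S s
  have hap : ∀ s y, pm μ S s * p s y = P s y := by
    intro s y
    by_cases h : pm μ S s = 0
    · rw [h, zero_mul]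
      exact le_antisymm (hP0 s y) (h ▸ hleS s y)
    · simp only [p, if_neg h]
      field_simp
  have hpt : ∀ s y, pm μ S s * (p s y * Real.log (p s y / pm μ Y y))
      = P s y * Real.log (P s y) - P s y * Real.log (pm μ S s)
        - P s y * Real.log (pm μ Y y) := by
    intro s y
    rw [← mul_assoc, hap]
    rcases (hP0 s y).eq_or_lt with h | h
    · simp [← h]
    · have hs := h.trans_le (hleS s y)
      have hy := h.trans_le (hleY s y)
      simp only [p, if_neg hs.ne']
      rw [Real.log_div (by positivity) hy.ne', Real.log_div h.ne' hs.ne']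
      ring
  refine ⟨p, fun s y => ?_, fun s => ?_, fun s y h => ?_, hap, ?_⟩
  · simp only [p]
    split_ifs
    exacts [pm_nonneg μ Y y, div_nonneg (hP0 s y) (pm_nonneg μ S s)]
  · by_cases h : pm μ S s = 0
    · simp only [p, if_pos h]
      exact sum_pm μ hY
    · simp only [p, if_neg h]
      rw [← Finset.sum_div, hPS, div_self h]
  · by_cases hs : pm μ S s = 0
    · simpa only [p, if_pos hs] using h
    · have hs' : 0 < pm μ S s := (pm_nonneg μ S s).lt_of_ne' hs
      exact (hap s y ▸ mul_pos hs' h).trans_le (hleY s y)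
  · have hS1 : ∑ s, ∑ y, P s y * Real.log (pm μ S s) = -∑ s, Real.negMulLog (pm μ S s) := by
      simp_rw [← Finset.sum_mul, hPS, Real.negMulLog, neg_mul, Finset.sum_neg_distrib, neg_neg]
    have hY1 : ∑ s, ∑ y, P s y * Real.log (pm μ Y y) = -∑ y, Real.negMulLog (pm μ Y y) := by
      rw [Finset.sum_comm]
      simp_rw [← Finset.sum_mul, hPY, Real.negMulLog, neg_mul, Finset.sum_neg_distrib, neg_neg]
    have hSY : ∑ s, ∑ y, P s y * Real.log (P s y) = -∑ s, ∑ y, Real.negMulLog (P s y) := by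
      simp_rw [Real.negMulLog, neg_mul, Finset.sum_neg_distrib, neg_neg]
    simp_rw [Finset.mul_sum, hpt, Finset.sum_sub_distrib]
    rw [hS1, hY1, hSY, mi, ent_eq_sum_negMulLog, ent_eq_sum_negMulLog, ent_eq_sum_negMulLog,
      ← add_div, ← sub_div, div_mul_cancel₀ _ (Real.log_pos one_lt_two).ne',
      Fintype.sum_prod_type]
    ring

/-- achievability of `L_h^2(ε)` in Theorem 1. For `0 ≤ ε < I(S;Y)` and
`α = ε/H(S)` there is a probability space carrying `(S',Y')` distributed as `(S,Y)` and a
finite-valued `U` with `I(U;S') ≤ ε` and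
`I(U;Y') ≥ H(Y|S) − α·H(S|Y) + ε − (1−α)·(log₂(I(S;Y)+1) + 4)`. -/
theorem exists_ESFRL_lower_bound_L2
    {Ω : Type*} [MeasurableSpace Ω] (μ : Measure Ω) [IsProbabilityMeasure μ]
    {𝒮 𝒴 : Type*}
    [Fintype 𝒮] [Nonempty 𝒮] [MeasurableSpace 𝒮] [MeasurableSingletonClass 𝒮]
    [Fintype 𝒴] [Nonempty 𝒴] [MeasurableSpace 𝒴] [MeasurableSingletonClass 𝒴]
    (S : Ω → 𝒮) (Y : Ω → 𝒴) (hS : Measurable S) (hY : Measurable Y)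
    (ε : ℝ) (hε0 : 0 ≤ ε) (hε : ε < mi μ S Y)
    (α : ℝ) (hα : α = ε / ent μ S) :
    ∃ (Ω' : Type) (mΩ' : MeasurableSpace Ω'), haveI := mΩ';
    ∃ (μ' : Measure Ω'), IsProbabilityMeasure μ' ∧
    ∃ (S' : Ω' → 𝒮) (Y' : Ω' → 𝒴), Measurable S' ∧ Measurable Y' ∧
      Measure.map (fun ω => (S' ω, Y' ω)) μ' = Measure.map (fun ω => (S ω, Y ω)) μ ∧
      ∃ (𝒰 : Type) (iF : Fintype 𝒰) (iN : Nonempty 𝒰) (iM : MeasurableSpace 𝒰),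
        haveI := iF; haveI := iM;
      ∃ (iMS : MeasurableSingletonClass 𝒰) (U : Ω' → 𝒰), Measurable U ∧
        mi μ' U S' ≤ ε ∧
        condEnt μ Y S - α * condEnt μ S Y + ε
            - (1 - α) * (Real.logb 2 (mi μ S Y + 1) + 4) ≤ mi μ' U Y' := by
  classical
  have hlog2 : 0 < Real.log 2 := Real.log_pos one_lt_two
  have hHS : mi μ S Y ≤ ent μ S := by
    have := condEnt_nonneg μ hS hY
    rw [condEnt] at this
    rw [mi]
    linarith
  have hHS0 : 0 < ent μ S := by linarith
  have hα0 : 0 ≤ α := hα ▸ div_nonneg hε0 hHS0.le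
  have hα1 : α ≤ 1 := by rw [hα, div_le_one hHS0]; linarith
  have hαε : α * ent μ S = ε := by rw [hα]; field_simp
  obtain ⟨p, hp0, hp1, hpq, hap, hI⟩ := exists_conditional_law μ hS hY
  obtain ⟨N, w, f, hw0, hw1, hfp, hH⟩ :=
    exists_strong_functional_representation (pm_nonneg μ S) (sum_pm μ hS) hp0 hp1 (pm_nonneg μ Y)
      (sum_pm μ hY) hpq (hε0.trans hε.le) hI
  let e := (Fintype.equivFin 𝒮).symm
  set a : Fin (Fintype.card 𝒮) → ℝ := fun i => pm μ S (e i) with ha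
  have ha1 : ∑ i, a i = 1 := by rw [ha, e.sum_comp (pm μ S), sum_pm μ hS]
  have hρ : ∀ x, 0 ≤ erasureWeight w a α x :=
    erasureWeight_nonneg hw0 (fun i => pm_nonneg μ S (e i)) hα0 hα1
  set μ' := finLaw (erasureWeight w a α)
  have hprob : IsProbabilityMeasure μ' :=
    isProbabilityMeasure_finLaw hρ (sum_erasureWeight hw1 ha1)
  let S' : Fin N × Fin (Fintype.card 𝒮) × Bool → 𝒮 := fun x => e x.2.1
  let Y' : Fin N × Fin (Fintype.card 𝒮) × Bool → 𝒴 := fun x => f x.1 (e x.2.1)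
  have hS' : Measurable S' := Measurable.of_discrete
  have hY' : Measurable Y' := Measurable.of_discrete
  have hjoint : ∀ s y, pm μ' (fun x => (S' x, Y' x)) (s, y)
      = pm μ (fun ω => (S ω, Y ω)) (s, y) := by
    intro s y
    rw [← hap, ← hfp, Finset.mul_sum]
    refine (pm_erasure_law hρ (fun c i => (e i, f c (e i))) (s, y)).trans
      (Finset.sum_congr rfl fun c _ => ?_)
    rw [e.sum_comp fun i => if (i, f c i) = (s, y) then pm μ S i else 0]
    simp [ite_and, mul_comm]
  have hentS : ent μ' S' = ent μ S := by
    rw [ent_eq_sum_negMulLog, ent_eq_sum_negMulLog]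
    simp_rw [← sum_pm_prod_right μ' hS' hY', ← sum_pm_prod_right μ hS hY, hjoint]
  have hentY : ent μ' Y' = ent μ Y := by
    rw [ent_eq_sum_negMulLog, ent_eq_sum_negMulLog]
    simp_rw [← sum_pm_prod_left μ' hS' hY', ← sum_pm_prod_left μ hS hY, hjoint]
  have hUS : ent μ' (fun x => (erasure x, S' x)) = ent μ' erasure + (1 - α) * ent μ S := by
    rw [ent_erasure_prod hρ ha1 fun _ i => e i, ent_eq_sum_negMulLog μ S, mul_div_assoc]
    congr 3
    have : ∀ z, ∑ i, (if e i = z then a i else 0) = pm μ S z := by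
      intro z
      rw [e.sum_comp fun i => if i = z then pm μ S i else 0]
      simp
    simp_rw [this, ← Finset.sum_mul, hw1, one_mul]
  have hUY : ent μ' (fun x => (erasure x, Y' x)) ≤ ent μ' erasure +
      (1 - α) * (mi μ S Y + (Real.logb 2 (mi μ S Y + 1) + 4)) := by
    rw [ent_erasure_prod hρ ha1 fun c i => f c (e i), mul_div_assoc]
    have h1α : 0 ≤ 1 - α := by linarith
    gcongr
    rw [div_le_iff₀ hlog2, mul_comm _ (Real.log 2)]
    refine le_trans (le_of_eq ?_) hH
    refine Finset.sum_congr rfl fun c _ => ?_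
    congr 1
    refine Finset.sum_congr rfl fun z _ => ?_
    rw [e.sum_comp fun i => if f c i = z then pm μ S i else 0]
  have hN : Nonempty (Fin N) := by
    by_contra h
    rw [not_nonempty_iff] at h
    simp at hw1
  refine ⟨Fin N × Fin (Fintype.card 𝒮) × Bool, inferInstance, μ', hprob, S', Y', hS', hY', ?_,
    Fin N × Option (Fin (Fintype.card 𝒮)), inferInstance, inferInstance, ⊤,
    @MeasurableSingletonClass.mk _ ⊤ fun _ => trivial, erasure, fun _ _ => MeasurableSet.of_discrete, ?_, ?_⟩
  · have hSY := hS.prodMk hY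
    have hSY' := hS'.prodMk hY'
    refine Measure.ext_of_singleton fun z => ?_
    rw [Measure.map_apply hSY' (measurableSet_singleton z),
      Measure.map_apply hSY (measurableSet_singleton z)]
    exact (ENNReal.toReal_eq_toReal_iff' (measure_ne_top _ _) (measure_ne_top _ _)).1
      (hjoint z.1 z.2)
  · rw [mi, hUS, hentS]
    linarith
  · have hmi : mi μ' erasure Y' =
        ent μ' erasure + ent μ Y - ent μ' (fun x => (erasure x, Y' x)) := by rw [mi, hentY]
    rw [hmi]
    have hswap := ent_prod_swap μ S Y
    refine le_trans (le_of_eq ?_) (sub_le_sub_left hUY _)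
    rw [condEnt, condEnt, hswap, ← hαε]
    simp only [mi]
    ring
end
end
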